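/- If p is a well-typed program of λF_{S,v} (a closed plain term delimited by a reset, typable in empty environments), then the call-by-value evaluation of p terminates: there exists a value v such that p →v* ⟨v⟩. -/

import Mathlib

/-!
Language `λF_{S,v}`: explicitly typed System F extended with the
delimited-control operators shift (`S k.t`), reset (`⟨t⟩`) and throw
(`k ← t`, `⌈E⌉ ← t`), under call by value, in de Bruijn representation
(separate de Bruijn indices for term variables, continuation variables and
type variables).
-/

namespace LambdaFShift

/-- Term types: `S ::= α | (S/T → U/V) | ∀α.(S,T,U)`.
In `∀α.(S,T,U)` the quantifier binds `α` in all three components. -/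
inductive Ty : Type where
  | var : Nat → Ty
  | arrow : Ty → Ty → Ty → Ty → Ty
  | all : Ty → Ty → Ty → Ty

/-- Lifting of a renaming under a binder. -/
def liftRen (ρ : Nat → Nat) : Nat → Nat
  | 0 => 0
  | n+1 => ρ n + 1

/-- Renaming of type variables in a type. -/
def renTy (ρ : Nat → Nat) : Ty → Ty
  | .var n => .var (ρ n)
  | .arrow a b c d => .arrow (renTy ρ a) (renTy ρ b) (renTy ρ c) (renTy ρ d)
  | .all a b c => .all (renTy (liftRen ρ) a) (renTy (liftRen ρ) b) (renTy (liftRen ρ) c)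

/-- Lifting of a type substitution under a type binder. -/
def liftTySub (σ : Nat → Ty) : Nat → Ty
  | 0 => .var 0
  | n+1 => renTy Nat.succ (σ n)

/-- Simultaneous substitution of types for type variables in a type. -/
def subTy (σ : Nat → Ty) : Ty → Ty
  | .var n => σ n
  | .arrow a b c d => .arrow (subTy σ a) (subTy σ b) (subTy σ c) (subTy σ d)
  | .all a b c => .all (subTy (liftTySub σ) a) (subTy (liftTySub σ) b) (subTy (liftTySub σ) c)

/-- `subTy0 U S` is `S[α₀ := U]`. -/
def subTy0 (U : Ty) (S : Ty) : Ty :=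
  subTy (fun n => match n with | 0 => U | n+1 => .var n) S

/-- `subTyList Ts S` is `S[ᾱ := Ts]`. -/
def subTyList (Ts : List Ty) (S : Ty) : Ty :=
  subTy (fun n => Ts.getD n (.var n)) S

/-- `ScopedTy p S`: all free type variables of `S` are `< p`. -/
inductive ScopedTy : Nat → Ty → Prop where
  | var : ∀ {p n}, n < p → ScopedTy p (.var n)
  | arrow : ∀ {p a b c d}, ScopedTy p a → ScopedTy p b → ScopedTy p c → ScopedTy p d →
      ScopedTy p (.arrow a b c d)
  | all : ∀ {p a b c}, ScopedTy (p+1) a → ScopedTy (p+1) b → ScopedTy (p+1) c →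
      ScopedTy p (.all a b c)

/-- A closed type. -/
def ClosedTy (S : Ty) : Prop := ScopedTy 0 S

mutual
/-- Terms of `λF_{S,v}`: variables, `λx:S.t`, application, `Λα.t`, type
application, `S k.t` (shift), `⟨t⟩` (reset), `k ← t` and `⌈E⌉ ← t` (throw). -/
inductive Tm : Type where
  | var : Nat → Tm
  | lam : Ty → Tm → Tm
  | app : Tm → Tm → Tm
  | tlam : Tm → Tm
  | tapp : Tm → Ty → Tm
  | shift : Tm → Tm
  | reset : Tm → Tm
  | throwVar : Nat → Tm → Tm
  | throwCtx : Ctx → Tm → Tm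

/-- Call-by-value evaluation contexts, represented inside-out:
`[]`, `(λx:S.t)·E`, `E t`, `E S`, `⌈E₀⌉ ← E`. -/
inductive Ctx : Type where
  | hole : Ctx
  | lamApp : Ty → Tm → Ctx → Ctx
  | app : Ctx → Tm → Ctx
  | tapp : Ctx → Ty → Ctx
  | throw : Ctx → Ctx → Ctx
end

/-- Metacontexts: stacks of contexts, `F ::= • | E·F`. -/
abbrev MCtx : Type := List Ctx

/-- Plugging a term in a context. -/
def plug : Tm → Ctx → Tm
  | t, .hole => t
  | t, .lamApp S b E => plug (.app (.lam S b) t) E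
  | t, .app E u => plug (.app t u) E
  | t, .tapp E S => plug (.tapp t S) E
  | t, .throw E0 E => plug (.throwCtx E0 t) E

/-- Plugging a term in a metacontext:
`plugm t • = t` and `plugm t (E·F) = plugm ⟨E[t]⟩ F`.
In particular `plugm t (E::F)` is `F[⟨E[t]⟩]`. -/
def plugm : Tm → MCtx → Tm
  | t, [] => t
  | t, E :: F => plugm (.reset (plug t E)) F

/-- Values: λ-abstractions and Λ-abstractions. -/
inductive IsValue : Tm → Prop where
  | lam : ∀ {S t}, IsValue (.lam S t)
  | tlam : ∀ {t}, IsValue (.tlam t)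

/-- Plain terms: no subterm of the form `⌈E⌉ ← t`. -/
inductive Plain : Tm → Prop where
  | var : ∀ {n}, Plain (.var n)
  | lam : ∀ {S t}, Plain t → Plain (.lam S t)
  | app : ∀ {a b}, Plain a → Plain b → Plain (.app a b)
  | tlam : ∀ {t}, Plain t → Plain (.tlam t)
  | tapp : ∀ {t S}, Plain t → Plain (.tapp t S)
  | shift : ∀ {t}, Plain t → Plain (.shift t)
  | reset : ∀ {t}, Plain t → Plain (.reset t)
  | throwVar : ∀ {k t}, Plain t → Plain (.throwVar k t)

mutual
/-- Scoping predicate for terms: free term variables `< n`, free continuation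
variables `< m`, free type variables `< p`. -/
inductive ScTm : Nat → Nat → Nat → Tm → Prop where
  | var : ∀ {n m p x}, x < n → ScTm n m p (.var x)
  | lam : ∀ {n m p S t}, ScopedTy p S → ScTm (n+1) m p t → ScTm n m p (.lam S t)
  | app : ∀ {n m p a b}, ScTm n m p a → ScTm n m p b → ScTm n m p (.app a b)
  | tlam : ∀ {n m p t}, ScTm n m (p+1) t → ScTm n m p (.tlam t)
  | tapp : ∀ {n m p t S}, ScTm n m p t → ScopedTy p S → ScTm n m p (.tapp t S)
  | shift : ∀ {n m p t}, ScTm n (m+1) p t → ScTm n m p (.shift t)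
  | reset : ∀ {n m p t}, ScTm n m p t → ScTm n m p (.reset t)
  | throwVar : ∀ {n m p k t}, k < m → ScTm n m p t → ScTm n m p (.throwVar k t)
  | throwCtx : ∀ {n m p E t}, ScCtx n m p E → ScTm n m p t → ScTm n m p (.throwCtx E t)

/-- Scoping predicate for contexts. -/
inductive ScCtx : Nat → Nat → Nat → Ctx → Prop where
  | hole : ∀ {n m p}, ScCtx n m p .hole
  | lamApp : ∀ {n m p S t E}, ScopedTy p S → ScTm (n+1) m p t → ScCtx n m p E →
      ScCtx n m p (.lamApp S t E)
  | app : ∀ {n m p E t}, ScCtx n m p E → ScTm n m p t → ScCtx n m p (.app E t)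
  | tapp : ∀ {n m p E S}, ScCtx n m p E → ScopedTy p S → ScCtx n m p (.tapp E S)
  | throw : ∀ {n m p E0 E1}, ScCtx n m p E0 → ScCtx n m p E1 → ScCtx n m p (.throw E0 E1)
end

/-- A closed term. -/
def ClosedTm (t : Tm) : Prop := ScTm 0 0 0 t

/-- A closed context. -/
def ClosedCtx (E : Ctx) : Prop := ScCtx 0 0 0 E

/-- A closed metacontext. -/
def ClosedMCtx (F : MCtx) : Prop := ∀ E ∈ F, ClosedCtx E

mutual
/-- Renaming of the three kinds of variables in terms. -/
def renTm (ρx ρk ρa : Nat → Nat) : Tm → Tm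
  | .var n => .var (ρx n)
  | .lam S t => .lam (renTy ρa S) (renTm (liftRen ρx) ρk ρa t)
  | .app a b => .app (renTm ρx ρk ρa a) (renTm ρx ρk ρa b)
  | .tlam t => .tlam (renTm ρx ρk (liftRen ρa) t)
  | .tapp t S => .tapp (renTm ρx ρk ρa t) (renTy ρa S)
  | .shift t => .shift (renTm ρx (liftRen ρk) ρa t)
  | .reset t => .reset (renTm ρx ρk ρa t)
  | .throwVar k t => .throwVar (ρk k) (renTm ρx ρk ρa t)
  | .throwCtx E t => .throwCtx (renCtx ρx ρk ρa E) (renTm ρx ρk ρa t)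

/-- Renaming of the three kinds of variables in contexts. -/
def renCtx (ρx ρk ρa : Nat → Nat) : Ctx → Ctx
  | .hole => .hole
  | .lamApp S t E => .lamApp (renTy ρa S) (renTm (liftRen ρx) ρk ρa t) (renCtx ρx ρk ρa E)
  | .app E t => .app (renCtx ρx ρk ρa E) (renTm ρx ρk ρa t)
  | .tapp E S => .tapp (renCtx ρx ρk ρa E) (renTy ρa S)
  | .throw E0 E => .throw (renCtx ρx ρk ρa E0) (renCtx ρx ρk ρa E)
end

/-- Action of a context transformer on continuation-substitution entries. -/
def mapKEnt (f : Ctx → Ctx) : Ctx ⊕ Nat → Ctx ⊕ Nat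
  | .inl E => .inl (f E)
  | .inr n => .inr n

/-- Lifting of a term substitution under a term binder. -/
def liftSubX (σ : Nat → Tm) : Nat → Tm
  | 0 => .var 0
  | n+1 => renTm Nat.succ id id (σ n)

/-- Shifting of a term substitution under a continuation binder. -/
def shiftSubXk (σ : Nat → Tm) : Nat → Tm := fun n => renTm id Nat.succ id (σ n)

/-- Shifting of a term substitution under a type binder. -/
def shiftSubXa (σ : Nat → Tm) : Nat → Tm := fun n => renTm id id Nat.succ (σ n)

/-- Lifting of a continuation substitution under a continuation binder. -/
def liftSubK (σ : Nat → Ctx ⊕ Nat) : Nat → Ctx ⊕ Nat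
  | 0 => .inr 0
  | n+1 =>
    match σ n with
    | .inl E => .inl (renCtx id Nat.succ id E)
    | .inr m => .inr (m+1)

/-- Shifting of a continuation substitution under a term binder. -/
def shiftSubKx (σ : Nat → Ctx ⊕ Nat) : Nat → Ctx ⊕ Nat :=
  fun n => mapKEnt (renCtx Nat.succ id id) (σ n)

/-- Shifting of a continuation substitution under a type binder. -/
def shiftSubKa (σ : Nat → Ctx ⊕ Nat) : Nat → Ctx ⊕ Nat :=
  fun n => mapKEnt (renCtx id id Nat.succ) (σ n)

mutual
/-- Simultaneous capture-avoiding substitution in terms. -/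
def subTm (σx : Nat → Tm) (σk : Nat → Ctx ⊕ Nat) (σa : Nat → Ty) : Tm → Tm
  | .var n => σx n
  | .lam S t => .lam (subTy σa S) (subTm (liftSubX σx) (shiftSubKx σk) σa t)
  | .app a b => .app (subTm σx σk σa a) (subTm σx σk σa b)
  | .tlam t => .tlam (subTm (shiftSubXa σx) (shiftSubKa σk) (liftTySub σa) t)
  | .tapp t S => .tapp (subTm σx σk σa t) (subTy σa S)
  | .shift t => .shift (subTm (shiftSubXk σx) (liftSubK σk) σa t)
  | .reset t => .reset (subTm σx σk σa t)
  | .throwVar k t =>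
    match σk k with
    | .inl E => .throwCtx E (subTm σx σk σa t)
    | .inr m => .throwVar m (subTm σx σk σa t)
  | .throwCtx E t => .throwCtx (subCtx σx σk σa E) (subTm σx σk σa t)

/-- Simultaneous capture-avoiding substitution in contexts. -/
def subCtx (σx : Nat → Tm) (σk : Nat → Ctx ⊕ Nat) (σa : Nat → Ty) : Ctx → Ctx
  | .hole => .hole
  | .lamApp S t E => .lamApp (subTy σa S) (subTm (liftSubX σx) (shiftSubKx σk) σa t) (subCtx σx σk σa E)
  | .app E t => .app (subCtx σx σk σa E) (subTm σx σk σa t)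
  | .tapp E S => .tapp (subCtx σx σk σa E) (subTy σa S)
  | .throw E0 E => .throw (subCtx σx σk σa E0) (subCtx σx σk σa E)
end

/-- `sub0X v t` is `t[x₀ := v]`. -/
def sub0X (v : Tm) (t : Tm) : Tm :=
  subTm (fun n => match n with | 0 => v | n+1 => .var n) Sum.inr Ty.var t

/-- `sub0A S t` is `t[α₀ := S]`. -/
def sub0A (S : Ty) (t : Tm) : Tm :=
  subTm Tm.var Sum.inr (fun n => match n with | 0 => S | n+1 => .var n) t

/-- `sub0K E t` is `t[k₀ := ⌈E⌉]`. -/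
def sub0K (E : Ctx) (t : Tm) : Tm :=
  subTm Tm.var (fun n => match n with | 0 => .inl E | n+1 => .inr n) Ty.var t

/-- `msub Vs vs Es t` is the simultaneous substitution
`t[ᾱ := Vs][x̄ := vs][k̄ := ⌈Es⌉]`. -/
def msub (Vs : List Ty) (vs : List Tm) (Es : List Ctx) (t : Tm) : Tm :=
  subTm (fun n => vs.getD n (.var n))
        (fun n => match Es[n]? with | some E => .inl E | none => .inr n)
        (fun n => Vs.getD n (.var n)) t

mutual
/-- The type system of Figure 2: typing of terms.
`HasTy Γ Δ T t S U` encodes the judgment `Γ;Δ,T ⊢ t : S,U`, where `Γ` assigns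
term types to term variables and `Δ` assigns context types `¬(S,T)`
(represented by the pair `(S,T)`) to continuation variables. -/
inductive HasTy : List Ty → List (Ty × Ty) → Ty → Tm → Ty → Ty → Prop where
  | var : ∀ {Γ Δ x S T}, Γ[x]? = some S → HasTy Γ Δ T (.var x) S T
  | lam : ∀ {Γ Δ S T U V W t}, HasTy (S::Γ) Δ U t T V →
      HasTy Γ Δ W (.lam S t) (.arrow S T U V) W
  | app : ∀ {Γ Δ S T U V W X t0 t1},
      HasTy Γ Δ X t0 (.arrow S T U W) V → HasTy Γ Δ W t1 S X →
      HasTy Γ Δ U (.app t0 t1) T V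
  | tlam : ∀ {Γ Δ S T U V t},
      HasTy (Γ.map (renTy Nat.succ)) (Δ.map (fun C => (renTy Nat.succ C.1, renTy Nat.succ C.2))) T t S U →
      HasTy Γ Δ V (.tlam t) (.all S T U) V
  | tapp : ∀ {Γ Δ S T U V W t},
      HasTy Γ Δ (subTy0 V U) t (.all S T U) W →
      HasTy Γ Δ (subTy0 V T) (.tapp t V) (subTy0 V S) W
  | reset : ∀ {Γ Δ S T U t}, HasTy Γ Δ U t U S → HasTy Γ Δ T (.reset t) S T
  | shift : ∀ {Γ Δ S T U V t}, HasTy Γ ((S,T)::Δ) V t V U →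
      HasTy Γ Δ T (.shift t) S U
  | throwVar : ∀ {Γ Δ k S T U V t}, Δ[k]? = some (S,T) → HasTy Γ Δ U t S V →
      HasTy Γ Δ U (.throwVar k t) T V
  | throwCtx : ∀ {Γ Δ E S T U V t}, HasTyCtx Γ Δ E S T → HasTy Γ Δ U t S V →
      HasTy Γ Δ U (.throwCtx E t) T V

/-- The type system of Figure 2: typing of contexts.
`HasTyCtx Γ Δ E S T` encodes `Γ;Δ ⊢ E : ¬(S,T)`. -/
inductive HasTyCtx : List Ty → List (Ty × Ty) → Ctx → Ty → Ty → Prop where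
  | hole : ∀ {Γ Δ S}, HasTyCtx Γ Δ .hole S S
  | app : ∀ {Γ Δ S T U V W t E},
      HasTyCtx Γ Δ E T U → HasTy Γ Δ V t S W →
      HasTyCtx Γ Δ (.app E t) (.arrow S T U V) W
  | lamApp : ∀ {Γ Δ S T U V W t E},
      HasTy Γ Δ W (.lam S t) (.arrow S T U V) W → HasTyCtx Γ Δ E T U →
      HasTyCtx Γ Δ (.lamApp S t E) S V
  | tapp : ∀ {Γ Δ S T U V E},
      HasTyCtx Γ Δ E (subTy0 V S) (subTy0 V T) →
      HasTyCtx Γ Δ (.tapp E V) (.all S T U) (subTy0 V U)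
  | throw : ∀ {Γ Δ S T U E' E},
      HasTyCtx Γ Δ E' S T → HasTyCtx Γ Δ E T U →
      HasTyCtx Γ Δ (.throw E' E) S U
end

/-- The type system of Figure 2: typing of metacontexts.
`HasTyMCtx Γ Δ F S` encodes `Γ;Δ ⊢ F : ¬¬S`. -/
inductive HasTyMCtx : List Ty → List (Ty × Ty) → MCtx → Ty → Prop where
  | nil : ∀ {Γ Δ S}, HasTyMCtx Γ Δ ([] : MCtx) S
  | cons : ∀ {Γ Δ S T E F}, HasTyCtx Γ Δ E S T → HasTyMCtx Γ Δ F T →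
      HasTyMCtx Γ Δ (E :: F : MCtx) S

/-- The call-by-value one-step reduction relation `→v` of `λF_{S,v}`.
Note that `plugm r (E::F)` is the program `F[⟨E[r]⟩]`. -/
inductive Step : Tm → Tm → Prop where
  | beta : ∀ {S t v E F}, IsValue v →
      Step (plugm (.app (.lam S t) v) (E::F)) (plugm (sub0X v t) (E::F))
  | betaT : ∀ {t S E F},
      Step (plugm (.tapp (.tlam t) S) (E::F)) (plugm (sub0A S t) (E::F))
  | shift : ∀ {t E F},
      Step (plugm (.shift t) (E::F)) (plugm (.reset (sub0K E t)) F)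
  | throw : ∀ {E' E F v}, IsValue v →
      Step (plugm (.throwCtx E' v) (E::F)) (plugm v (E'::E::F))
  | reset : ∀ {v E F}, IsValue v →
      Step (plugm (.reset v) (E::F)) (plugm v (E::F))

/-- Call-by-value evaluation: the reflexive-transitive closure of `→v`. -/
def Steps : Tm → Tm → Prop := Relation.ReflTransGen Step

/-- Redexes of `λF_{S,v}` under call by value. -/
inductive IsRedex : Tm → Prop where
  | beta : ∀ {S t v}, IsValue v → IsRedex (.app (.lam S t) v)
  | betaT : ∀ {t S}, IsRedex (.tapp (.tlam t) S)
  | shift : ∀ {t}, IsRedex (.shift t)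
  | throw : ∀ {E v}, IsValue v → IsRedex (.throwCtx E v)
  | reset : ∀ {v}, IsValue v → IsRedex (.reset v)

/-- `Norm p`: the program `p` evaluates to a value delimited by a reset. -/
def Norm (p : Tm) : Prop := ∃ v, IsValue v ∧ Steps p (.reset v)

/-- A reducibility candidate of type `S` is a set of closed values of type `S`. -/
def IsCand (S : Ty) (R : Set Tm) : Prop :=
  ∀ v ∈ R, IsValue v ∧ ClosedTm v ∧ ∀ W, HasTy [] [] W v S W

/-- `MCtxOK R F` is the predicate `R ⊨⊨ F`, i.e. `∀ v ∈ R, norm (F[⟨v⟩])`. -/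
def MCtxOK (R : Set Tm) (F : MCtx) : Prop := ∀ v ∈ R, Norm (plugm (.reset v) F)

/-- `MCtxAdm U R F`: `F` is a closed metacontext of type `¬¬U` with `R ⊨⊨ F`. -/
def MCtxAdm (U : Ty) (R : Set Tm) (F : MCtx) : Prop :=
  ClosedMCtx F ∧ HasTyMCtx [] [] F U ∧ MCtxOK R F

/-- `CtxOK T R R' E` is the predicate `(R,R') ⊨ E`:
`∀ v ∈ R, ∀ F, R' ⊨⊨ F → norm (F[⟨E[v]⟩])`, where `T` is the type of the
candidate `R'` (so the metacontexts `F` range over closed metacontexts of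
type `¬¬T`). -/
def CtxOK (T : Ty) (R R' : Set Tm) (E : Ctx) : Prop :=
  ∀ v ∈ R, ∀ F, MCtxAdm T R' F → Norm (plugm v (E::F))

/-- `CtxAdm S T R R' E`: `E` is a closed context of type `¬(S,T)` with `(R,R') ⊨ E`. -/
def CtxAdm (S T : Ty) (R R' : Set Tm) (E : Ctx) : Prop :=
  ClosedCtx E ∧ HasTyCtx [] [] E S T ∧ CtxOK T R R' E

/-- The parametric reducibility candidate `RED_S(ᾱ ↦ R̄)` for `λF_{S,v}`,
defined by induction on `S`.  `Ts` are the types of the candidates `Rs`. -/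
def RED : Ty → List Ty → List (Set Tm) → Set Tm
  | .var i, _, Rs => Rs.getD i ∅
  | .arrow S T U V, Ts, Rs =>
      {v0 | IsValue v0 ∧ ClosedTm v0 ∧ (∀ W, HasTy [] [] W v0 (subTyList Ts (.arrow S T U V)) W) ∧
        ∀ v1 ∈ RED S Ts Rs,
          ∀ E, CtxAdm (subTyList Ts T) (subTyList Ts U) (RED T Ts Rs) (RED U Ts Rs) E →
          ∀ F, MCtxAdm (subTyList Ts V) (RED V Ts Rs) F →
            Norm (plugm (.app v0 v1) (E::F))}
  | .all S T U, Ts, Rs =>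
      {v | IsValue v ∧ ClosedTm v ∧ (∀ W, HasTy [] [] W v (subTyList Ts (.all S T U)) W) ∧
        ∀ (V : Ty) (Rc : Set Tm), IsCand V Rc →
          ∀ E, CtxAdm (subTyList (V::Ts) S) (subTyList (V::Ts) T)
                 (RED S (V::Ts) (Rc::Rs)) (RED T (V::Ts) (Rc::Rs)) E →
          ∀ F, MCtxAdm (subTyList (V::Ts) U) (RED U (V::Ts) (Rc::Rs)) F →
            Norm (plugm (.tapp v V) (E::F))}

end LambdaFShift
namespace LambdaFShift

/-! ### Substitution algebra for types -/

theorem liftRen_comp (r s : Nat → Nat) : liftRen r ∘ liftRen s = liftRen (r ∘ s) := by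
  funext n; cases n <;> rfl

theorem renTy_renTy (r s : Nat → Nat) (S : Ty) : renTy r (renTy s S) = renTy (r ∘ s) S := by
  induction S generalizing r s with
  | var => rfl
  | arrow => simp only [renTy, *]
  | all => simp only [renTy, liftRen_comp, *]

theorem liftTySub_comp_liftRen (σ : Nat → Ty) (r : Nat → Nat) :
    liftTySub σ ∘ liftRen r = liftTySub (σ ∘ r) := by
  funext n; cases n <;> rfl

theorem subTy_renTy (σ : Nat → Ty) (r : Nat → Nat) (S : Ty) :
    subTy σ (renTy r S) = subTy (σ ∘ r) S := by
  induction S generalizing σ r with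
  | var => rfl
  | arrow => simp only [renTy, subTy, *]
  | all => simp only [renTy, subTy, liftTySub_comp_liftRen, *]

theorem renTy_comp_liftTySub (r : Nat → Nat) (σ : Nat → Ty) :
    renTy (liftRen r) ∘ liftTySub σ = liftTySub (renTy r ∘ σ) := by
  funext n
  cases n with
  | zero => rfl
  | succ n => simp only [Function.comp, liftTySub, renTy_renTy]; rfl

theorem renTy_subTy (r : Nat → Nat) (σ : Nat → Ty) (S : Ty) :
    renTy r (subTy σ S) = subTy (renTy r ∘ σ) S := by
  induction S generalizing σ r with
  | var => rfl
  | arrow => simp only [renTy, subTy, *]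
  | all => simp only [renTy, subTy, renTy_comp_liftTySub, *]

theorem subTy_comp_liftTySub (τ σ : Nat → Ty) :
    subTy (liftTySub τ) ∘ liftTySub σ = liftTySub (subTy τ ∘ σ) := by
  funext n
  cases n with
  | zero => rfl
  | succ n => simp only [Function.comp, liftTySub, subTy_renTy, renTy_subTy]; rfl

theorem subTy_subTy (τ σ : Nat → Ty) (S : Ty) :
    subTy τ (subTy σ S) = subTy (subTy τ ∘ σ) S := by
  induction S generalizing σ τ with
  | var => rfl
  | arrow => simp only [subTy, *]
  | all => simp only [subTy, subTy_comp_liftTySub, *]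

theorem liftTySub_var : liftTySub Ty.var = Ty.var := by
  funext n; cases n <;> rfl

theorem subTy_var (S : Ty) : subTy Ty.var S = S := by
  induction S with
  | var => rfl
  | arrow => simp only [subTy, *]
  | all => simp only [subTy, liftTySub_var, *]

/-! ### Substitution algebra for terms and contexts -/

mutual
theorem renTm_renTm (rx rk ra sx sk sa : Nat → Nat) (t : Tm) :
    renTm rx rk ra (renTm sx sk sa t) = renTm (rx ∘ sx) (rk ∘ sk) (ra ∘ sa) t := by
  cases t <;> simp only [renTm, renTy_renTy, liftRen_comp, renTm_renTm, renCtx_renCtx,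
    Function.comp]

theorem renCtx_renCtx (rx rk ra sx sk sa : Nat → Nat) (E : Ctx) :
    renCtx rx rk ra (renCtx sx sk sa E) = renCtx (rx ∘ sx) (rk ∘ sk) (ra ∘ sa) E := by
  cases E <;> simp only [renCtx, renTy_renTy, liftRen_comp, renTm_renTm, renCtx_renCtx]
end

theorem liftSubX_comp_liftRen (σ : Nat → Tm) (r : Nat → Nat) :
    liftSubX σ ∘ liftRen r = liftSubX (σ ∘ r) := by
  funext n; cases n <;> rfl

theorem liftSubK_comp_liftRen (σ : Nat → Ctx ⊕ Nat) (r : Nat → Nat) :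
    liftSubK σ ∘ liftRen r = liftSubK (σ ∘ r) := by
  funext n; cases n <;> rfl

theorem shiftSubXk_comp (σ : Nat → Tm) (r : Nat → Nat) :
    shiftSubXk σ ∘ r = shiftSubXk (σ ∘ r) := rfl

theorem shiftSubXa_comp (σ : Nat → Tm) (r : Nat → Nat) :
    shiftSubXa σ ∘ r = shiftSubXa (σ ∘ r) := rfl

theorem shiftSubKx_comp (σ : Nat → Ctx ⊕ Nat) (r : Nat → Nat) :
    shiftSubKx σ ∘ r = shiftSubKx (σ ∘ r) := rfl

theorem shiftSubKa_comp (σ : Nat → Ctx ⊕ Nat) (r : Nat → Nat) :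
    shiftSubKa σ ∘ r = shiftSubKa (σ ∘ r) := rfl

mutual
theorem subTm_renTm (σx : Nat → Tm) (σk : Nat → Ctx ⊕ Nat) (σa : Nat → Ty)
    (rx rk ra : Nat → Nat) (t : Tm) :
    subTm σx σk σa (renTm rx rk ra t) = subTm (σx ∘ rx) (σk ∘ rk) (σa ∘ ra) t := by
  cases t <;> simp only [renTm, subTm, subTy_renTy, liftTySub_comp_liftRen,
    liftSubX_comp_liftRen, liftSubK_comp_liftRen, shiftSubXk_comp, shiftSubXa_comp,
    shiftSubKx_comp, shiftSubKa_comp, subTm_renTm, subCtx_renCtx] <;> rfl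

theorem subCtx_renCtx (σx : Nat → Tm) (σk : Nat → Ctx ⊕ Nat) (σa : Nat → Ty)
    (rx rk ra : Nat → Nat) (E : Ctx) :
    subCtx σx σk σa (renCtx rx rk ra E) = subCtx (σx ∘ rx) (σk ∘ rk) (σa ∘ ra) E := by
  cases E <;> simp only [renCtx, subCtx, subTy_renTy,
    liftSubX_comp_liftRen, shiftSubKx_comp, subTm_renTm, subCtx_renCtx]
end

/-- Renaming of continuation-substitution entries. -/
def renKEnt (rx rk ra : Nat → Nat) : Ctx ⊕ Nat → Ctx ⊕ Nat
  | .inl E => .inl (renCtx rx rk ra E)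
  | .inr n => .inr (rk n)

section RenamingAfterSubstitution

variable (rx rk ra : Nat → Nat) (σx : Nat → Tm) (σk : Nat → Ctx ⊕ Nat)

theorem renTm_comp_liftSubX :
    renTm (liftRen rx) rk ra ∘ liftSubX σx = liftSubX (renTm rx rk ra ∘ σx) := by
  funext n
  cases n with
  | zero => rfl
  | succ n => simp only [Function.comp, liftSubX, renTm_renTm]; rfl

theorem renTm_comp_shiftSubXk :
    renTm rx (liftRen rk) ra ∘ shiftSubXk σx = shiftSubXk (renTm rx rk ra ∘ σx) := by
  funext n
  simp only [Function.comp, shiftSubXk, renTm_renTm]; rfl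

theorem renTm_comp_shiftSubXa :
    renTm rx rk (liftRen ra) ∘ shiftSubXa σx = shiftSubXa (renTm rx rk ra ∘ σx) := by
  funext n
  simp only [Function.comp, shiftSubXa, renTm_renTm]; rfl

theorem renKEnt_comp_liftSubK :
    renKEnt rx (liftRen rk) ra ∘ liftSubK σk = liftSubK (renKEnt rx rk ra ∘ σk) := by
  funext n
  cases n with
  | zero => rfl
  | succ n =>
    cases h : σk n <;> simp only [Function.comp, liftSubK, renKEnt, h, renCtx_renCtx] <;> rfl

theorem renKEnt_comp_shiftSubKx :
    renKEnt (liftRen rx) rk ra ∘ shiftSubKx σk = shiftSubKx (renKEnt rx rk ra ∘ σk) := by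
  funext n
  cases h : σk n <;>
    simp only [Function.comp, shiftSubKx, mapKEnt, renKEnt, h, renCtx_renCtx]
  rfl

theorem renKEnt_comp_shiftSubKa :
    renKEnt rx rk (liftRen ra) ∘ shiftSubKa σk = shiftSubKa (renKEnt rx rk ra ∘ σk) := by
  funext n
  cases h : σk n <;>
    simp only [Function.comp, shiftSubKa, mapKEnt, renKEnt, h, renCtx_renCtx]
  rfl

end RenamingAfterSubstitution

mutual
theorem renTm_subTm (rx rk ra : Nat → Nat) (σx : Nat → Tm) (σk : Nat → Ctx ⊕ Nat)
    (σa : Nat → Ty) (t : Tm) :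
    renTm rx rk ra (subTm σx σk σa t) =
      subTm (renTm rx rk ra ∘ σx) (renKEnt rx rk ra ∘ σk) (renTy ra ∘ σa) t := by
  cases t with
  | throwVar k t =>
    cases h : σk k <;> simp only [subTm, renTm, Function.comp_apply, renKEnt, h, renTm_subTm]
  | _ => simp only [renTm, subTm, renTy_subTy, renTy_comp_liftTySub, renTm_comp_liftSubX,
      renTm_comp_shiftSubXk, renTm_comp_shiftSubXa, renKEnt_comp_liftSubK,
      renKEnt_comp_shiftSubKx, renKEnt_comp_shiftSubKa, renTm_subTm, renCtx_subCtx,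
      Function.comp_apply]

theorem renCtx_subCtx (rx rk ra : Nat → Nat) (σx : Nat → Tm) (σk : Nat → Ctx ⊕ Nat)
    (σa : Nat → Ty) (E : Ctx) :
    renCtx rx rk ra (subCtx σx σk σa E) =
      subCtx (renTm rx rk ra ∘ σx) (renKEnt rx rk ra ∘ σk) (renTy ra ∘ σa) E := by
  cases E <;> simp only [renCtx, subCtx, renTy_subTy, renTm_comp_liftSubX,
    renKEnt_comp_shiftSubKx, renTm_subTm, renCtx_subCtx]
end

/-- Substitution in continuation-substitution entries. -/
def subKEnt (σx : Nat → Tm) (σk : Nat → Ctx ⊕ Nat) (σa : Nat → Ty) : Ctx ⊕ Nat → Ctx ⊕ Nat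
  | .inl E => .inl (subCtx σx σk σa E)
  | .inr n => σk n

section SubstitutionAfterSubstitution

variable (τx : Nat → Tm) (τk : Nat → Ctx ⊕ Nat) (τa : Nat → Ty)
  (σx : Nat → Tm) (σk : Nat → Ctx ⊕ Nat)

theorem liftSubK_comp_succ :
    liftSubK τk ∘ Nat.succ = renKEnt id Nat.succ id ∘ τk := by
  funext n
  cases h : τk n <;> simp only [Function.comp, liftSubK, renKEnt, h]

theorem shiftSubKx_eq : shiftSubKx τk = renKEnt Nat.succ id id ∘ τk := by
  funext n
  cases h : τk n <;> simp only [Function.comp, shiftSubKx, mapKEnt, renKEnt, h, id]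

theorem shiftSubKa_eq : shiftSubKa τk = renKEnt id id Nat.succ ∘ τk := by
  funext n
  cases h : τk n <;> simp only [Function.comp, shiftSubKa, mapKEnt, renKEnt, h, id]

theorem renTy_id (S : Ty) : renTy id S = S := by
  have h : liftRen id = id := by funext n; cases n <;> rfl
  induction S with
  | var => rfl
  | arrow => simp only [renTy, *]
  | all => simp only [renTy, *]

theorem renTy_id_comp : renTy id ∘ τa = τa := funext fun _ => renTy_id _

theorem subTm_comp_liftSubX :
    subTm (liftSubX τx) (shiftSubKx τk) τa ∘ liftSubX σx = liftSubX (subTm τx τk τa ∘ σx) := by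
  funext n
  cases n with
  | zero => rfl
  | succ n =>
    simp only [Function.comp_apply, liftSubX, subTm_renTm, renTm_subTm, renTy_id_comp,
      shiftSubKx_eq]
    rfl

theorem subTm_comp_shiftSubXk :
    subTm (shiftSubXk τx) (liftSubK τk) τa ∘ shiftSubXk σx =
      shiftSubXk (subTm τx τk τa ∘ σx) := by
  funext n
  simp only [Function.comp_apply, shiftSubXk, subTm_renTm, renTm_subTm, renTy_id_comp,
    liftSubK_comp_succ]
  rfl

theorem subTm_comp_shiftSubXa :
    subTm (shiftSubXa τx) (shiftSubKa τk) (liftTySub τa) ∘ shiftSubXa σx =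
      shiftSubXa (subTm τx τk τa ∘ σx) := by
  funext n
  simp only [Function.comp_apply, shiftSubXa, subTm_renTm, renTm_subTm, shiftSubKa_eq]
  rfl

theorem subKEnt_comp_liftSubK :
    subKEnt (shiftSubXk τx) (liftSubK τk) τa ∘ liftSubK σk =
      liftSubK (subKEnt τx τk τa ∘ σk) := by
  funext n
  cases n with
  | zero => rfl
  | succ n =>
    cases h : σk n with
    | inl E =>
      simp only [Function.comp_apply, liftSubK, subKEnt, h, subCtx_renCtx, renCtx_subCtx,
        renTy_id_comp, liftSubK_comp_succ]
      rfl
    | inr m => simp only [Function.comp_apply, liftSubK, subKEnt, h]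

theorem subKEnt_comp_shiftSubKx :
    subKEnt (liftSubX τx) (shiftSubKx τk) τa ∘ shiftSubKx σk =
      shiftSubKx (subKEnt τx τk τa ∘ σk) := by
  funext n
  cases h : σk n with
  | inl E =>
    simp only [Function.comp_apply, shiftSubKx_eq, subKEnt, renKEnt, h, subCtx_renCtx,
      renCtx_subCtx, renTy_id_comp]
    rfl
  | inr m => simp only [Function.comp_apply, shiftSubKx, mapKEnt, subKEnt, h]

theorem subKEnt_comp_shiftSubKa :
    subKEnt (shiftSubXa τx) (shiftSubKa τk) (liftTySub τa) ∘ shiftSubKa σk =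
      shiftSubKa (subKEnt τx τk τa ∘ σk) := by
  funext n
  cases h : σk n with
  | inl E =>
    simp only [Function.comp_apply, shiftSubKa_eq, subKEnt, renKEnt, h, subCtx_renCtx,
      renCtx_subCtx]
    rfl
  | inr m => simp only [Function.comp_apply, shiftSubKa, mapKEnt, subKEnt, h]

end SubstitutionAfterSubstitution

mutual
theorem subTm_subTm (τx : Nat → Tm) (τk : Nat → Ctx ⊕ Nat) (τa : Nat → Ty)
    (σx : Nat → Tm) (σk : Nat → Ctx ⊕ Nat) (σa : Nat → Ty) (t : Tm) :
    subTm τx τk τa (subTm σx σk σa t) =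
      subTm (subTm τx τk τa ∘ σx) (subKEnt τx τk τa ∘ σk) (subTy τa ∘ σa) t := by
  cases t with
  | throwVar k t =>
    cases h : σk k <;> simp only [subTm, Function.comp_apply, subKEnt, h, subTm_subTm]
  | _ => simp only [subTm, subTy_subTy, subTy_comp_liftTySub, subTm_comp_liftSubX,
      subTm_comp_shiftSubXk, subTm_comp_shiftSubXa, subKEnt_comp_liftSubK,
      subKEnt_comp_shiftSubKx, subKEnt_comp_shiftSubKa, subTm_subTm, subCtx_subCtx,
      Function.comp_apply]

theorem subCtx_subCtx (τx : Nat → Tm) (τk : Nat → Ctx ⊕ Nat) (τa : Nat → Ty)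
    (σx : Nat → Tm) (σk : Nat → Ctx ⊕ Nat) (σa : Nat → Ty) (E : Ctx) :
    subCtx τx τk τa (subCtx σx σk σa E) =
      subCtx (subTm τx τk τa ∘ σx) (subKEnt τx τk τa ∘ σk) (subTy τa ∘ σa) E := by
  cases E <;> simp only [subCtx, subTy_subTy, subTm_comp_liftSubX,
    subKEnt_comp_shiftSubKx, subTm_subTm, subCtx_subCtx]
end

theorem liftSubX_var : liftSubX Tm.var = Tm.var := by
  funext n; cases n <;> rfl

theorem liftSubK_inr : liftSubK Sum.inr = Sum.inr := by
  funext n; cases n <;> rfl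

theorem shiftSubXk_var : shiftSubXk Tm.var = Tm.var := rfl

theorem shiftSubXa_var : shiftSubXa Tm.var = Tm.var := rfl

theorem shiftSubKx_inr : shiftSubKx Sum.inr = Sum.inr := rfl

theorem shiftSubKa_inr : shiftSubKa Sum.inr = Sum.inr := rfl

mutual
theorem subTm_var (t : Tm) : subTm Tm.var Sum.inr Ty.var t = t := by
  cases t <;> simp only [subTm, subTy_var, liftTySub_var, liftSubX_var, liftSubK_inr,
    shiftSubXk_var, shiftSubXa_var, shiftSubKx_inr, shiftSubKa_inr, subTm_var, subCtx_var]

theorem subCtx_var (E : Ctx) : subCtx Tm.var Sum.inr Ty.var E = E := by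
  cases E <;> simp only [subCtx, subTy_var, liftSubX_var, shiftSubKx_inr, subTm_var, subCtx_var]
end

/-- Extension of a sequence by a new entry at index `0`. -/
def scons {α : Type*} (a : α) (σ : Nat → α) : Nat → α
  | 0 => a
  | n+1 => σ n

theorem sub0X_subTm (v : Tm) (σx : Nat → Tm) (σk : Nat → Ctx ⊕ Nat) (σa : Nat → Ty) (t : Tm) :
    sub0X v (subTm (liftSubX σx) (shiftSubKx σk) σa t) = subTm (scons v σx) σk σa t := by
  rw [sub0X, subTm_subTm]
  congr 1
  · funext n
    cases n with
    | zero => rfl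
    | succ n => exact (subTm_renTm ..).trans (subTm_var _)
  · funext n
    cases h : σk n with
    | inl E =>
      simp only [Function.comp_apply, shiftSubKx, mapKEnt, subKEnt, h, subCtx_renCtx]
      exact congrArg Sum.inl (subCtx_var E)
    | inr m => simp only [Function.comp_apply, shiftSubKx, mapKEnt, subKEnt, h]
  · exact funext fun n => subTy_var _

theorem sub0K_subTm (E : Ctx) (σx : Nat → Tm) (σk : Nat → Ctx ⊕ Nat) (σa : Nat → Ty) (t : Tm) :
    sub0K E (subTm (shiftSubXk σx) (liftSubK σk) σa t) =
      subTm σx (scons (.inl E) σk) σa t := by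
  rw [sub0K, subTm_subTm]
  congr 1
  · exact funext fun n => (subTm_renTm ..).trans (subTm_var _)
  · funext n
    cases n with
    | zero => rfl
    | succ n =>
      cases h : σk n with
      | inl E =>
        simp only [Function.comp_apply, liftSubK, scons, subKEnt, h, subCtx_renCtx]
        exact congrArg Sum.inl (subCtx_var E)
      | inr m => simp only [Function.comp_apply, liftSubK, scons, subKEnt, h]
  · exact funext fun n => subTy_var _

theorem sub0A_subTm (S : Ty) (σx : Nat → Tm) (σk : Nat → Ctx ⊕ Nat) (σa : Nat → Ty) (t : Tm) :
    sub0A S (subTm (shiftSubXa σx) (shiftSubKa σk) (liftTySub σa) t) =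
      subTm σx σk (scons S σa) t := by
  rw [sub0A, subTm_subTm]
  congr 1
  · exact funext fun n => (subTm_renTm ..).trans (subTm_var _)
  · funext n
    cases h : σk n with
    | inl E =>
      simp only [Function.comp_apply, shiftSubKa, mapKEnt, subKEnt, h, subCtx_renCtx]
      exact congrArg Sum.inl (subCtx_var E)
    | inr m => simp only [Function.comp_apply, shiftSubKa, mapKEnt, subKEnt, h]
  · funext n
    cases n with
    | zero => rfl
    | succ n => exact (subTy_renTy ..).trans (subTy_var _)

/-! ### Semantic types -/

/-- `(R, R') ⊨ E`, with metacontexts ranging over all `F` such that `R' ⊨⊨ F`,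
regardless of typing. -/
def CtxSem (R R' : Set Tm) (E : Ctx) : Prop :=
  ∀ v ∈ R, ∀ F, MCtxOK R' F → Norm (plugm v (E :: F))

/-- `TmSem R R' R'' t`: the term `t` normalizes in every context satisfying `(R, R')`
and every metacontext satisfying `R''`. -/
def TmSem (R R' R'' : Set Tm) (t : Tm) : Prop :=
  ∀ E, CtxSem R R' E → ∀ F, MCtxOK R'' F → Norm (plugm t (E :: F))

/-- The untyped variant of `RED`: a set of values for each type, given an interpretation
of the type variables by arbitrary sets of terms. -/
def Sem : Ty → (Nat → Set Tm) → Set Tm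
  | .var i, ρ => {v | IsValue v ∧ v ∈ ρ i}
  | .arrow S T U V, ρ =>
      {v | (∃ A b, v = .lam A b) ∧ ∀ w ∈ Sem S ρ, TmSem (Sem T ρ) (Sem U ρ) (Sem V ρ) (.app v w)}
  | .all S T U, ρ =>
      {v | IsValue v ∧ ∀ (A : Ty) (R : Set Tm),
        TmSem (Sem S (scons R ρ)) (Sem T (scons R ρ)) (Sem U (scons R ρ)) (.tapp v A)}

theorem isValue_of_mem_Sem {S : Ty} {ρ : Nat → Set Tm} {v : Tm} (h : v ∈ Sem S ρ) : IsValue v := by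
  cases S with
  | var => exact h.1
  | arrow => obtain ⟨⟨A, b, rfl⟩, -⟩ := h; exact .lam
  | all => exact h.1

theorem scons_comp_liftRen (R : Set Tm) (ρ : Nat → Set Tm) (r : Nat → Nat) :
    scons R ρ ∘ liftRen r = scons R (ρ ∘ r) := by
  funext n; cases n <;> rfl

theorem Sem_renTy (r : Nat → Nat) (S : Ty) (ρ : Nat → Set Tm) :
    Sem (renTy r S) ρ = Sem S (ρ ∘ r) := by
  induction S generalizing r ρ with
  | var => rfl
  | arrow => simp only [renTy, Sem, *]
  | all => simp only [renTy, Sem, scons_comp_liftRen, *]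

theorem Sem_congr (S : Ty) {ρ ρ' : Nat → Set Tm}
    (h : ∀ n, Sem (.var n) ρ = Sem (.var n) ρ') : Sem S ρ = Sem S ρ' := by
  induction S generalizing ρ ρ' with
  | var n => exact h n
  | arrow S T U V ihS ihT ihU ihV => simp only [Sem, ihS h, ihT h, ihU h, ihV h]
  | all S T U ihS ihT ihU =>
    have h' (R : Set Tm) (n : Nat) : Sem (.var n) (scons R ρ) = Sem (.var n) (scons R ρ') := by
      cases n with
      | zero => rfl
      | succ n => exact h n
    simp only [Sem, ihS (h' _), ihT (h' _), ihU (h' _)]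

theorem setOf_isValue_and_mem_Sem (S : Ty) (ρ : Nat → Set Tm) :
    {v | IsValue v ∧ v ∈ Sem S ρ} = Sem S ρ :=
  Set.ext fun _ => ⟨And.right, fun h => ⟨isValue_of_mem_Sem h, h⟩⟩

theorem Sem_subTy (σ : Nat → Ty) (S : Ty) (ρ : Nat → Set Tm) :
    Sem (subTy σ S) ρ = Sem S (fun n => Sem (σ n) ρ) := by
  induction S generalizing σ ρ with
  | var n => exact (setOf_isValue_and_mem_Sem _ _).symm
  | arrow => simp only [subTy, Sem, *]
  | all S T U ihS ihT ihU =>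
    have h (X : Ty) (R : Set Tm) :
        Sem X (fun n => Sem (liftTySub σ n) (scons R ρ)) =
          Sem X (scons R fun n => Sem (σ n) ρ) := by
      refine Sem_congr X fun n => ?_
      cases n with
      | zero => exact setOf_isValue_and_mem_Sem (.var 0) (scons R ρ)
      | succ n =>
        have e : Sem (liftTySub σ (n + 1)) (scons R ρ) = Sem (σ n) ρ := Sem_renTy ..
        simp only [Sem, e]; rfl
    simp only [subTy, Sem, ihS, ihT, ihU, h]

theorem Sem_subTy0 (A S : Ty) (ρ : Nat → Set Tm) :
    Sem (subTy0 A S) ρ = Sem S (scons (Sem A ρ) ρ) := by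
  rw [subTy0, Sem_subTy]
  refine Sem_congr S fun n => ?_
  cases n with
  | zero => rfl
  | succ n => exact setOf_isValue_and_mem_Sem (.var n) ρ

theorem Norm.of_step {p q : Tm} (h : Step p q) : Norm q → Norm p
  | ⟨v, hv, hs⟩ => ⟨v, hv, .head h hs⟩

theorem CtxSem.hole (R : Set Tm) : CtxSem R R .hole := fun v hv _ hF => hF v hv

theorem CtxSem.mctxOK_cons {S : Ty} {ρ : Nat → Set Tm} {R : Set Tm} {E : Ctx} {F : MCtx}
    (hE : CtxSem (Sem S ρ) R E) (hF : MCtxOK R F) : MCtxOK (Sem S ρ) (E :: F) :=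
  fun v hv => .of_step (.reset (isValue_of_mem_Sem hv)) (hE v hv F hF)

theorem TmSem.of_mem {R R' : Set Tm} {v : Tm} (hv : v ∈ R) : TmSem R R' R' v :=
  fun _ hE F hF => hE v hv F hF

/-- The fundamental lemma of the logical relation. -/
theorem TmSem.of_hasTy {t : Tm} (hp : Plain t) {Γ : List Ty} {Δ : List (Ty × Ty)} {S T U : Ty}
    (ht : HasTy Γ Δ T t S U) {ρ : Nat → Set Tm}
    {σx : Nat → Tm} {σk : Nat → Ctx ⊕ Nat} {σa : Nat → Ty}
    (hx : ∀ n A, Γ[n]? = some A → σx n ∈ Sem A ρ)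
    (hk : ∀ n A B, Δ[n]? = some (A, B) → ∃ E, σk n = .inl E ∧ CtxSem (Sem A ρ) (Sem B ρ) E) :
    TmSem (Sem S ρ) (Sem T ρ) (Sem U ρ) (subTm σx σk σa t) := by
  induction hp generalizing Γ Δ S T U ρ σx σk σa with
  | var => cases ht with | var h => exact .of_mem (hx _ _ h)
  | lam hp ih =>
    cases ht with
    | lam ht =>
      refine .of_mem ⟨⟨_, _, rfl⟩, fun w hw E hE F hF => .of_step (.beta (isValue_of_mem_Sem hw)) ?_⟩
      rw [sub0X_subTm]
      refine ih ht (fun n A h => ?_) hk E hE F hF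
      cases n with
      | zero => cases h; exact hw
      | succ n => exact hx n A h
  | app hp₀ hp₁ ih₀ ih₁ =>
    cases ht with
    | app ht₀ ht₁ =>
      intro E hE F hF
      refine ih₀ ht₀ hx hk (.app E _) (fun v hv F₁ hF₁ => ?_) F hF
      obtain ⟨⟨A, b, rfl⟩, hv⟩ := hv
      exact ih₁ ht₁ hx hk (.lamApp A b E) (fun w hw F₂ hF₂ => hv w hw E hE F₂ hF₂) F₁ hF₁
  | tlam hp ih =>
    cases ht with
    | tlam ht =>
      refine .of_mem ⟨.tlam, fun A R E hE F hF => .of_step .betaT ?_⟩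
      rw [sub0A_subTm]
      refine ih ht (fun n B h => ?_) (fun n B C h => ?_) E hE F hF
      · rw [List.getElem?_map, Option.map_eq_some_iff] at h
        obtain ⟨B, h, rfl⟩ := h
        rw [Sem_renTy]
        exact hx n B h
      · rw [List.getElem?_map, Option.map_eq_some_iff] at h
        obtain ⟨⟨B, C⟩, h, e⟩ := h
        cases e
        rw [Sem_renTy, Sem_renTy]
        exact hk n B C h
  | tapp hp ih =>
    cases ht with
    | tapp ht =>
      intro E hE F hF
      refine ih ht hx hk (.tapp E _) (fun v hv F₁ hF₁ => ?_) F hF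
      rw [Sem_subTy0] at hF₁
      rw [Sem_subTy0, Sem_subTy0] at hE
      exact hv.2 _ _ E hE F₁ hF₁
  | shift hp ih =>
    cases ht with
    | shift ht =>
      intro E hE F hF
      refine .of_step .shift ?_
      rw [sub0K_subTm]
      refine ih ht hx (fun n A B h => ?_) .hole (.hole _) F hF
      cases n with
      | zero => cases h; exact ⟨E, rfl, hE⟩
      | succ n => exact hk n A B h
  | reset hp ih =>
    cases ht with
    | reset ht =>
      exact fun E hE F hF => ih ht hx hk .hole (.hole _) (E :: F) (hE.mctxOK_cons hF)
  | throwVar hp ih =>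
    cases ht with
    | throwVar h ht =>
      obtain ⟨E', e, hE'⟩ := hk _ _ _ h
      intro E hE F hF
      simp only [subTm, e]
      exact ih ht hx hk (.throw E' E) (fun v hv F₁ hF₁ =>
        .of_step (.throw (isValue_of_mem_Sem hv)) (hE' v hv (E :: F₁) (hE.mctxOK_cons hF₁))) F hF

/-- **Termination of call-by-value evaluation in `λF_{S,v}`** (Theorem 6).
If `p` is a well-typed program (a closed plain term delimited by a reset,
typable in the empty environments), then the call-by-value evaluation of `p`
terminates: there exists a value `v` such that `p →v* ⟨v⟩`. -/
theorem termination_cbv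
    (p : Tm) (hclosed : ClosedTm p) (hplain : Plain p)
    (hreset : ∃ t, p = Tm.reset t)
    (htyped : ∃ S T U, HasTy ([] : List Ty) ([] : List (Ty × Ty)) T p S U) :
    ∃ v, IsValue v ∧ Steps p (.reset v) := by
  obtain ⟨t, rfl⟩ := hreset
  obtain ⟨S, T, U, ht⟩ := htyped
  cases hplain with
  | reset hp =>
    cases ht with
    | reset ht =>
      have h := TmSem.of_hasTy hp ht (ρ := fun _ => ∅) (σx := .var) (σk := .inr) (σa := .var)
        (by simp) (by simp)
      rw [subTm_var] at h
      exact h .hole (.hole _) [] fun v hv => ⟨v, (isValue_of_mem_Sem hv), .refl⟩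

end LambdaFShift
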